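/- Let Δ be an irreducible (possibly non-reduced) root system in a finite-dimensional real inner product space E. If α, β ∈ Δ, α + β ∈ Δ and ‖α‖ < ‖β‖, then ‖α+β‖ = ‖α‖. (Unequal-length case of the paper's lemma on root lengths.) -/

import Mathlib

open RealInnerProductSpace

/-- Unequal-length case of the paper's lemma on root lengths (Lemma 4.3): if `α`, `β`
and `α + β` are roots of an irreducible (possibly non-reduced) root system `Δ` and
`‖α‖ < ‖β‖`, then `‖α + β‖ = ‖α‖`. -/
theorem root_length_unequal_case {E : Type*} [NormedAddCommGroup E]
    [InnerProductSpace ℝ E] [FiniteDimensional ℝ E]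
    (Δ : Finset E)
    (h0 : (0 : E) ∉ Δ)
    (hspan : Submodule.span ℝ (Δ : Set E) = ⊤)
    (hint : ∀ α ∈ Δ, ∀ β ∈ Δ, ∃ n : ℤ, 2 * ⟪β, α⟫ / ⟪α, α⟫ = (n : ℝ))
    (hrefl : ∀ α ∈ Δ, ∀ β ∈ Δ, β - (2 * ⟪β, α⟫ / ⟪α, α⟫) • α ∈ Δ)
    (hirr : ∀ A B : Set E, (Δ : Set E) = A ∪ B → A.Nonempty → B.Nonempty →
      (∀ a ∈ A, ∀ b ∈ B, ⟪a, b⟫ = 0) → False)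
    (α β : E) (hα : α ∈ Δ) (hβ : β ∈ Δ) (hαβ : α + β ∈ Δ)
    (hlen : ‖α‖ < ‖β‖) :
    ‖α + β‖ = ‖α‖ := by
  have ha : 0 < ⟪α, α⟫ := by
    rw [real_inner_self_eq_norm_sq]
    have : α ≠ 0 := fun h => h0 (h ▸ hα)
    positivity
  have hab : ⟪α, α⟫ < ⟪β, β⟫ := by
    rw [real_inner_self_eq_norm_sq, real_inner_self_eq_norm_sq]
    have := norm_nonneg α
    nlinarith
  have hcs : ⟪α, β⟫ * ⟪α, β⟫ ≤ ⟪α, α⟫ * ⟪β, β⟫ := real_inner_mul_inner_self_le α β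
  have hg : ⟪α + β, α + β⟫ = ⟪α, α⟫ + 2 * ⟪α, β⟫ + ⟪β, β⟫ := real_inner_add_add_self α β
  have hag : ⟪α, α + β⟫ = ⟪α, α⟫ + ⟪α, β⟫ := inner_add_right _ _ _
  obtain ⟨n, hn⟩ := hint β hβ α hα
  obtain ⟨m, hm⟩ := hint (α + β) hαβ α hα
  suffices h : ⟪α + β, α + β⟫ = ⟪α, α⟫ by
    rw [real_inner_self_eq_norm_sq, real_inner_self_eq_norm_sq] at h
    exact (sq_eq_sq₀ (norm_nonneg _) (norm_nonneg _)).1 h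
  rw [hag, hg] at hm
  rw [hg]
  generalize ⟪α, α⟫ = a at *
  generalize ⟪β, β⟫ = b at *
  generalize ⟪α, β⟫ = c at *
  have hb : 0 < b := ha.trans hab
  rw [div_eq_iff hb.ne'] at hn
  have hn4 : (n : ℝ) * n < 4 := by
    have h1 : (n * n : ℝ) * (b * b) < 4 * (b * b) := by
      have : (n * n : ℝ) * (b * b) = 4 * (c * c) := by linear_combination (-(n * b) - 2 * c) * hn
      nlinarith
    exact lt_of_mul_lt_mul_right h1 (by positivity)
  have hn4' : n * n < 4 := by exact_mod_cast hn4
  have h1 : n < 2 := by nlinarith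
  have h2 : -2 < n := by nlinarith
  have key : 0 ≤ c → False := by
    intro hc
    have hpos : 0 < a + 2 * c + b := by linarith
    have l1 : (0 : ℝ) < m := by rw [← hm]; positivity
    have l2 : (m : ℝ) < 1 := by rw [← hm, div_lt_one hpos]; linarith
    have l1' : 0 < m := by exact_mod_cast l1
    have l2' : m < 1 := by exact_mod_cast l2
    omega
  interval_cases n
  · push_cast at hn; linarith
  · exact (key (by push_cast at hn; linarith)).elim
  · exact (key (by push_cast at hn; linarith)).elim
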